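/- For every element ω of the second exterior power ⋀²(ℤ⁶), there exist a ℤ-linear automorphism f of ℤ⁶ and integers a, b, c with 0 ≤ a, 0 ≤ b, a ∣ b and b ∣ c, such that the induced automorphism ⋀²f of ⋀²(ℤ⁶) sends ω to a·(e₁∧e₂) + b·(e₃∧e₄) + c·(e₅∧e₆). -/

import Mathlib

open ExteriorAlgebra

/-- The image in the exterior algebra of the `i`-th standard basis vector of `ℤⁿ`. -/
noncomputable def e {n : ℕ} (i : Fin n) : ExteriorAlgebra ℤ (Fin n → ℤ) :=
  ι ℤ (Pi.single i 1)

/-- Splitting off the first two coordinates of `ℤⁿ⁺²`. -/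
def finAddTwoEquiv (n : ℕ) : (Fin (n + 2) → ℤ) ≃ₗ[ℤ] (ℤ × ℤ) × (Fin n → ℤ) where
  toFun u := ((u 0, u 1), Fin.tail (Fin.tail u))
  invFun p := Fin.cons p.1.1 (Fin.cons p.1.2 p.2)
  map_add' _ _ := rfl
  map_smul' _ _ := rfl
  left_inv u := by
    funext i
    refine Fin.cases rfl (fun j => ?_) i
    exact Fin.cases rfl (fun _ => rfl) j
  right_inv _ := rfl

/-- A nonzero alternating form over `ℤ` attains a positive value dividing all its values on
either of the two arguments at which it is attained. -/
lemma exists_minimal_pos_value {N : Type*} [AddCommGroup N] {B : LinearMap.BilinForm ℤ N}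
    (hB : B.IsAlt) (h0 : B ≠ 0) :
    ∃ d : ℤ, 0 < d ∧ (∃ x y, B x y = d) ∧
      ∀ x y, B x y = d → ∀ z, d ∣ B x z ∧ d ∣ B z y := by
  have hex : ∃ d : ℕ, 0 < d ∧ ∃ x y, B x y = d := by
    obtain ⟨x, y, hxy⟩ : ∃ x y, B x y ≠ 0 := by
      by_contra! h
      exact h0 (LinearMap.ext₂ h)
    refine ⟨(B x y).natAbs, Int.natAbs_pos.mpr hxy, ?_⟩
    rcases Int.natAbs_eq (B x y) with h | h
    · exact ⟨x, y, h⟩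
    · exact ⟨-x, y, by simp only [map_neg, LinearMap.neg_apply]; omega⟩
  classical
  obtain ⟨hpos, hval⟩ := Nat.find_spec hex
  have hmin : ∀ m : ℕ, 0 < m → (∃ x y, B x y = m) → Nat.find hex ≤ m :=
    fun m hm h => Nat.find_min' hex ⟨hm, h⟩
  generalize Nat.find hex = d at hpos hval hmin
  have key : ∀ x y, B x y = d → ∀ z, (d : ℤ) ∣ B x z := by
    intro x y hxy z
    have hr : B x (z - (B x z / d) • y) = B x z % d := by
      rw [map_sub, map_smul, hxy, smul_eq_mul, Int.emod_def, mul_comm]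
    have hd : (0 : ℤ) < d := by exact_mod_cast hpos
    have h1 := Int.emod_nonneg (B x z) hd.ne'
    have h2 := Int.emod_lt_of_pos (B x z) hd
    rw [Int.dvd_iff_emod_eq_zero]
    by_contra hne
    have := hmin (B x z % d).toNat (by omega) ⟨x, _, hr.trans (by omega)⟩
    omega
  refine ⟨d, by exact_mod_cast hpos, hval, fun x y hxy z => ⟨key x y hxy z, ?_⟩⟩
  have h := key (-y) x (by rw [map_neg, LinearMap.neg_apply, hB.neg_eq, hxy]) z
  rwa [map_neg, LinearMap.neg_apply, hB.neg_eq] at h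

/-- Splitting a hyperbolic plane of minimal scale off an alternating form over `ℤ`. -/
lemma exists_split_plane {n : ℕ} {B : LinearMap.BilinForm ℤ (Fin (n + 2) → ℤ)} (hB : B.IsAlt) :
    ∃ (d : ℤ) (B' : LinearMap.BilinForm ℤ (Fin n → ℤ))
      (Φ : (Fin (n + 2) → ℤ) ≃ₗ[ℤ] (Fin (n + 2) → ℤ)),
      0 ≤ d ∧ B'.IsAlt ∧ (∀ u v, d ∣ B' u v) ∧
      ∀ u v, B (Φ u) (Φ v) = d * (u 0 * v 1 - u 1 * v 0) +
        B' (Fin.tail (Fin.tail u)) (Fin.tail (Fin.tail v)) := by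
  by_cases h0 : B = 0
  · exact ⟨0, 0, .refl ℤ _, le_rfl, fun _ => rfl, fun _ _ => by simp, by simp [h0]⟩
  obtain ⟨d, hd, ⟨x, y, hxy⟩, hdvd⟩ := exists_minimal_pos_value hB h0
  have hyx : B y x = -d := by rw [← hB.neg_eq, hxy]
  let N' : Submodule ℤ (Fin (n + 2) → ℤ) := LinearMap.ker (B x) ⊓ LinearMap.ker (B y)
  have hx' : ∀ z : N', B x z = 0 := fun z => z.2.1
  have hy' : ∀ z : N', B y z = 0 := fun z => z.2.2
  have hx'' : ∀ z : N', B z x = 0 := fun z => by rw [← hB.neg_eq, hx', neg_zero]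
  have hy'' : ∀ z : N', B z y = 0 := fun z => by rw [← hB.neg_eq, hy', neg_zero]
  have hdvd' : ∀ z w : N', d ∣ B z w := by
    intro z w
    have h := (hdvd (x + z) y (by simp [hxy, hy'']) w).1
    simpa [hx'] using h
  let L : (ℤ × ℤ) × N' →ₗ[ℤ] (Fin (n + 2) → ℤ) :=
    ((LinearMap.toSpanSingleton ℤ _ x).coprod (LinearMap.toSpanSingleton ℤ _ y)).coprod N'.subtype
  have hL : ∀ p, L p = p.1.1 • x + p.1.2 • y + p.2 := fun _ => rfl
  have hBL : ∀ p q, B (L p) (L q) = d * (p.1.1 * q.1.2 - p.1.2 * q.1.1) + B p.2 q.2 := by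
    intro p q
    simp only [hL, map_add, map_smul, LinearMap.add_apply, LinearMap.smul_apply, smul_eq_mul,
      hxy, hyx, hx', hy', hx'', hy'', hB.self_eq_zero]
    ring
  have hinj : Function.Injective L := by
    rw [← LinearMap.ker_eq_bot, LinearMap.ker_eq_bot']
    intro p hp
    have h1 : p.1.1 = 0 := by
      have := hBL p ((0, 1), 0)
      simpa [hp, hd.ne'] using this
    have h2 : p.1.2 = 0 := by
      have := hBL p ((1, 0), 0)
      simpa [hp, hd.ne'] using this
    have h3 : p.2 = 0 := by simpa [hL, h1, h2] using hp
    exact Prod.ext (Prod.ext h1 h2) h3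
  have hsurj : Function.Surjective L := by
    intro z
    obtain ⟨s, hs⟩ := (hdvd x y hxy z).1
    obtain ⟨t, ht⟩ := (hdvd x y hxy z).2
    have ht' : B y z = -(d * t) := by rw [← hB.neg_eq, ht]
    refine ⟨((t, s), ⟨z - t • x - s • y, ?_, ?_⟩), ?_⟩
    · simp only [SetLike.mem_coe, LinearMap.mem_ker, map_sub, map_smul, smul_eq_mul, hxy, hs,
        hB.self_eq_zero]
      ring
    · simp only [SetLike.mem_coe, LinearMap.mem_ker, map_sub, map_smul, smul_eq_mul, hyx, ht',
        hB.self_eq_zero]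
      ring
    · rw [hL]; dsimp only; abel
  let E := LinearEquiv.ofBijective L ⟨hinj, hsurj⟩
  have hrank : Module.finrank ℤ (Fin n → ℤ) = Module.finrank ℤ N' := by
    have := E.finrank_eq
    simp only [Module.finrank_prod, Module.finrank_self, Module.finrank_fin_fun] at this ⊢
    omega
  let g : (Fin n → ℤ) ≃ₗ[ℤ] N' := LinearEquiv.ofFinrankEq _ _ hrank
  refine ⟨d, B.compl₁₂ (N'.subtype ∘ₗ g.toLinearMap) (N'.subtype ∘ₗ g.toLinearMap),
    finAddTwoEquiv n ≪≫ₗ (LinearEquiv.refl ℤ (ℤ × ℤ)).prodCongr g ≪≫ₗ E, hd.le,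
    fun u => hB.self_eq_zero _, fun u v => hdvd' (g u) (g v), fun u v => ?_⟩
  exact hBL ((u 0, u 1), g (Fin.tail (Fin.tail u))) ((v 0, v 1), g (Fin.tail (Fin.tail v)))

/-- Normal form of an alternating form on `ℤ⁶`. -/
lemma exists_alternating_form_normal_form {B : LinearMap.BilinForm ℤ (Fin 6 → ℤ)} (hB : B.IsAlt) :
    ∃ (Φ : (Fin 6 → ℤ) ≃ₗ[ℤ] (Fin 6 → ℤ)) (a b c : ℤ),
      0 ≤ a ∧ 0 ≤ b ∧ a ∣ b ∧ b ∣ c ∧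
      ∀ u v, B (Φ u) (Φ v) = a * (u 0 * v 1 - u 1 * v 0) + b * (u 2 * v 3 - u 3 * v 2) +
        c * (u 4 * v 5 - u 5 * v 4) := by
  have dvd_scale : ∀ {n : ℕ} {k d : ℤ} {C : LinearMap.BilinForm ℤ (Fin (n + 2) → ℤ)}
      {C' : LinearMap.BilinForm ℤ (Fin n → ℤ)} {Ψ : (Fin (n + 2) → ℤ) ≃ₗ[ℤ] (Fin (n + 2) → ℤ)},
      (∀ u v, k ∣ C u v) → (∀ u v, C (Ψ u) (Ψ v) = d * (u 0 * v 1 - u 1 * v 0) +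
        C' (Fin.tail (Fin.tail u)) (Fin.tail (Fin.tail v))) → k ∣ d := by
    intro n k d C C' Ψ hk hC
    have h := hk (Ψ (Pi.single 0 1)) (Ψ (Pi.single 1 1))
    have h0 : Fin.tail (Fin.tail (Pi.single 0 1 : Fin (n + 2) → ℤ)) = 0 := by
      funext i
      exact Pi.single_eq_of_ne (Fin.succ_ne_zero _) (1 : ℤ)
    simpa [hC, h0] using h
  obtain ⟨a, B₁, Φ₁, ha, hB₁, hdvd₁, h₁⟩ := exists_split_plane (n := 4) hB
  obtain ⟨b, B₂, Φ₂, hb, hB₂, hdvd₂, h₂⟩ := exists_split_plane (n := 2) hB₁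
  obtain ⟨c, B₃, Φ₃, -, -, -, h₃⟩ := exists_split_plane (n := 0) hB₂
  let lift (n : ℕ) (Ψ : (Fin n → ℤ) ≃ₗ[ℤ] (Fin n → ℤ)) :
      (Fin (n + 2) → ℤ) ≃ₗ[ℤ] (Fin (n + 2) → ℤ) :=
    finAddTwoEquiv n ≪≫ₗ (LinearEquiv.refl ℤ (ℤ × ℤ)).prodCongr Ψ ≪≫ₗ (finAddTwoEquiv n).symm
  refine ⟨lift 4 (lift 2 Φ₃ ≪≫ₗ Φ₂) ≪≫ₗ Φ₁, a, b, c, ha, hb, dvd_scale hdvd₁ h₂,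
    dvd_scale hdvd₂ h₃, fun u v => ?_⟩
  have hB₃ : ∀ u v, B₃ u v = 0 := fun u v => by
    rw [Subsingleton.elim u 0, map_zero, LinearMap.zero_apply]
  have e₁ := h₁ (lift 4 (lift 2 Φ₃ ≪≫ₗ Φ₂) u) (lift 4 (lift 2 Φ₃ ≪≫ₗ Φ₂) v)
  have e₂ := h₂ (lift 2 Φ₃ (Fin.tail (Fin.tail u))) (lift 2 Φ₃ (Fin.tail (Fin.tail v)))
  have e₃ := h₃ (Fin.tail (Fin.tail (Fin.tail (Fin.tail u))))
    (Fin.tail (Fin.tail (Fin.tail (Fin.tail v))))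
  rw [hB₃, add_zero] at e₃
  refine e₁.trans (Eq.trans ?_ (add_assoc _ _ _).symm)
  refine congrArg₂ (· + ·) rfl (e₂.trans ?_)
  exact congrArg₂ (· + ·) rfl e₃

/-- The bivector `∑ Uᵢⱼ eᵢ ∧ eⱼ` attached to a square integer matrix. -/
noncomputable def Matrix.bivector {n : ℕ} :
    Matrix (Fin n) (Fin n) ℤ →ₗ[ℤ] ExteriorAlgebra ℤ (Fin n → ℤ) where
  toFun U := ∑ i, ∑ j, U i j • (e i * e j)
  map_add' U V := by simp [add_smul, Finset.sum_add_distrib]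
  map_smul' k U := by simp [mul_smul, Finset.smul_sum]

namespace Matrix

variable {n : ℕ}

lemma bivector_apply (U : Matrix (Fin n) (Fin n) ℤ) :
    bivector U = ∑ i, ∑ j, U i j • (e i * e j) := rfl

lemma bivector_single (i j : Fin n) (a : ℤ) : bivector (single i j a) = a • (e i * e j) := by
  rw [bivector_apply, Finset.sum_eq_single i, Finset.sum_eq_single j]
  · simp
  · intro k _ hk
    simp [single_apply_of_col_ne _ _ hk.symm]
  · simp
  · intro k _ hk
    simp [single_apply_of_row_ne hk.symm]
  · simp

lemma bivector_eq_zero {S : Matrix (Fin n) (Fin n) ℤ} (hS : S.IsSymm) : bivector S = 0 := by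
  rw [bivector_apply, ← Finset.sum_product']
  refine Finset.sum_involution (fun p _ => p.swap) ?_ ?_ (by simp) (by simp)
  · rintro ⟨i, j⟩ -
    dsimp only [Prod.swap]
    rw [hS.apply, ← smul_add]
    simp [e, ι_add_mul_swap]
  · rintro ⟨i, j⟩ - hne heq
    obtain rfl : j = i := congrArg Prod.fst heq
    exact hne (by simp [e])

lemma ι_eq_sum (u : Fin n → ℤ) : ι ℤ u = ∑ i, u i • e i := by
  conv_lhs => rw [pi_eq_sum_univ' u]
  simp only [map_sum, map_smul, e]

lemma bivector_vecMulVec (u v : Fin n → ℤ) : bivector (vecMulVec u v) = ι ℤ u * ι ℤ v := by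
  simp only [ι_eq_sum, bivector_apply, Finset.sum_mul_sum, vecMulVec_apply, smul_mul_smul_comm]

lemma map_bivector (F U : Matrix (Fin n) (Fin n) ℤ) :
    ExteriorAlgebra.map (toLin' F) (bivector U) = bivector (F * U * Fᵀ) := by
  have h : (ExteriorAlgebra.map (toLin' F)).toLinearMap ∘ₗ bivector =
      bivector ∘ₗ (LinearMap.mulRight ℤ Fᵀ ∘ₗ LinearMap.mulLeft ℤ F) := by
    refine Matrix.ext_linearMap ℤ fun i j => LinearMap.ext_ring ?_
    have hs : (single i j 1 : Matrix (Fin n) (Fin n) ℤ) =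
        vecMulVec (Pi.single i 1) (Pi.single j 1) := single_eq_single_vecMulVec_single i j
    simp [hs, bivector_vecMulVec, Matrix.mul_vecMulVec, Matrix.vecMulVec_mul, vecMul_transpose]
  exact LinearMap.congr_fun h U

lemma exists_bivector_eq {ω : ExteriorAlgebra ℤ (Fin n → ℤ)} (hω : ω ∈ ⋀[ℤ]^2 (Fin n → ℤ)) :
    ∃ U, bivector U = ω := by
  rw [exteriorPower, pow_two] at hω
  refine Submodule.mul_induction_on hω ?_ ?_
  · rintro _ ⟨u, rfl⟩ _ ⟨v, rfl⟩
    exact ⟨vecMulVec u v, bivector_vecMulVec u v⟩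
  · rintro _ _ ⟨U, rfl⟩ ⟨V, rfl⟩
    exact ⟨U + V, map_add _ _ _⟩

end Matrix

open Matrix in
/-- Existence half of the normal form theorem for elements of `⋀²(ℤ⁶)`: every
`ω ∈ ⋀²(ℤ⁶)` can be carried by an automorphism of `ℤ⁶` to
`a·(e₁∧e₂) + b·(e₃∧e₄) + c·(e₅∧e₆)` with `0 ≤ a`, `0 ≤ b`, `a ∣ b` and `b ∣ c`. -/
theorem normal_form_exists (ω : ExteriorAlgebra ℤ (Fin 6 → ℤ))
    (hω : ω ∈ ⋀[ℤ]^2 (Fin 6 → ℤ)) :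
    ∃ (f : (Fin 6 → ℤ) ≃ₗ[ℤ] (Fin 6 → ℤ)) (a b c : ℤ),
      0 ≤ a ∧ 0 ≤ b ∧ a ∣ b ∧ b ∣ c ∧
      ExteriorAlgebra.map f.toLinearMap ω =
        a • (e 0 * e 1) + b • (e 2 * e 3) + c • (e 4 * e 5) := by
  obtain ⟨U, rfl⟩ := exists_bivector_eq hω
  let B : LinearMap.BilinForm ℤ (Fin 6 → ℤ) := toLinearMap₂' ℤ (U - Uᵀ)
  have hB : B.IsAlt := by
    intro u
    rw [toLinearMap₂'_apply', sub_mulVec, dotProduct_sub, mulVec_transpose, dotProduct_mulVec,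
      dotProduct_comm u, sub_self]
  obtain ⟨Φ, a, b, c, ha, hb, hab, hbc, hΦ⟩ := exists_alternating_form_normal_form hB
  let G := LinearMap.toMatrix' Φ.toLinearMap
  let G' := LinearMap.toMatrix' Φ.symm.toLinearMap
  have hGG' : G * G' = 1 := by
    rw [← LinearMap.toMatrix'_comp]; simp
  have hG'G : G' * G = 1 := by
    rw [← LinearMap.toMatrix'_comp]; simp
  let f := toLin'OfInv (M := G'ᵀ) (M' := Gᵀ)
    (by rw [← transpose_mul, hGG', transpose_one]) (by rw [← transpose_mul, hG'G, transpose_one])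
  refine ⟨f, a, b, c, ha, hb, hab, hbc, ?_⟩
  have hf : f.toLinearMap = toLin' Gᵀ := rfl
  rw [hf, map_bivector, transpose_transpose, ← bivector_single, ← bivector_single,
    ← bivector_single, ← map_add, ← map_add, ← sub_eq_zero, ← map_sub]
  apply bivector_eq_zero
  have hcongr : Gᵀ * U * G - (Gᵀ * U * G)ᵀ = (single 0 1 a + single 2 3 b + single 4 5 c) -
      (single 0 1 a + single 2 3 b + single 4 5 c)ᵀ := by
    have : Gᵀ * U * G - (Gᵀ * U * G)ᵀ = Gᵀ * (U - Uᵀ) * G := by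
      simp [transpose_mul, Matrix.mul_sub, Matrix.sub_mul, Matrix.mul_assoc]
    rw [this]
    have hform : LinearMap.toMatrix₂' ℤ (B.compl₁₂ Φ.toLinearMap Φ.toLinearMap) =
        Gᵀ * (U - Uᵀ) * G := by
      rw [LinearMap.toMatrix₂'_compl₁₂, LinearMap.toMatrix'_toLinearMap₂']
    rw [← hform]
    ext k l
    rw [LinearMap.toMatrix₂'_apply, LinearMap.compl₁₂_apply]
    refine (hΦ _ _).trans ?_
    fin_cases k <;> fin_cases l <;> simp
  rw [IsSymm, transpose_sub]
  exact (sub_eq_sub_iff_sub_eq_sub.mpr hcongr).symm
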